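/- For the 27-hyperplane arrangement A in ℚ(ζ)³, the multiset of multiplicities |A_p| over all rank-2 intersection points p (one-dimensional elements of L(A)) is {{2^15, 3^70, 7^6}}; i.e., there are 15 points lying on exactly 2 hyperplanes, 70 points on exactly 3 hyperplanes, and 6 points on exactly 7 hyperplanes. -/

import Mathlib

open Module Matrix
open scoped Classical

namespace Arrgt

variable {K : Type*} [Field K]

/-- A (central) hyperplane arrangement in `K^n`: a finite set of kernels of
nonzero linear forms. -/
structure Arrangement (K : Type*) [Field K] (n : ℕ) where
  hyperplanes : Finset (Submodule K (Fin n → K))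
  isHyp : ∀ H ∈ hyperplanes, ∃ f : (Fin n → K) →ₗ[K] K, f ≠ 0 ∧ H = LinearMap.ker f

/-- The deletion `A \ {H}`. -/
noncomputable def Arrangement.delete {n : ℕ} (A : Arrangement K n) (H : Submodule K (Fin n → K)) :
    Arrangement K n :=
  ⟨A.hyperplanes.erase H, fun H' hH' => A.isHyp H' (Finset.mem_of_mem_erase hH')⟩

/-- The empty arrangement of rank `n`. -/
def emptyArr (K : Type*) [Field K] (n : ℕ) : Arrangement K n := ⟨∅, by simp⟩

/-- The linear polynomial in `K[x_1,...,x_n]` attached to a linear form. -/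
noncomputable def linPoly {n : ℕ} (f : (Fin n → K) →ₗ[K] K) : MvPolynomial (Fin n) K :=
  ∑ i, MvPolynomial.C (f (Pi.single i 1)) * MvPolynomial.X i

/-- `Q` is a defining polynomial of the arrangement `A`: a product of linear forms
whose kernels are exactly the hyperplanes of `A`. -/
def IsDefiningPoly {n : ℕ} (A : Arrangement K n) (Q : MvPolynomial (Fin n) K) : Prop :=
  ∃ α : Submodule K (Fin n → K) → ((Fin n → K) →ₗ[K] K),
    (∀ H ∈ A.hyperplanes, α H ≠ 0 ∧ LinearMap.ker (α H) = H) ∧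
    Q = ∏ H ∈ A.hyperplanes, linPoly (α H)

/-- Evaluation of a derivation at the polynomial `Q`, as a linear map. -/
noncomputable def evalDer {n : ℕ} (Q : MvPolynomial (Fin n) K) :
    Derivation K (MvPolynomial (Fin n) K) (MvPolynomial (Fin n) K) →ₗ[MvPolynomial (Fin n) K]
      MvPolynomial (Fin n) K where
  toFun θ := θ Q
  map_add' _ _ := rfl
  map_smul' _ _ := rfl

/-- The module `D(A) = {θ : θ(Q) ∈ Q·S}` of `A`-derivations (for a chosen defining
polynomial `Q`). -/
noncomputable def DerModule {n : ℕ} (Q : MvPolynomial (Fin n) K) :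
    Submodule (MvPolynomial (Fin n) K)
      (Derivation K (MvPolynomial (Fin n) K) (MvPolynomial (Fin n) K)) :=
  Submodule.comap (evalDer Q) (Ideal.span {Q})

/-- `A` is a free arrangement: `D(A)` is a free module over `S = K[x_1,...,x_n]`. -/
def IsFree {n : ℕ} (A : Arrangement K n) : Prop :=
  ∃ Q, IsDefiningPoly A Q ∧ Module.Free (MvPolynomial (Fin n) K) (DerModule Q)

/-- A nonzero derivation is homogeneous of polynomial degree `p` if all its
coefficients are homogeneous of degree `p`. -/
def IsHomogeneousDer {n : ℕ}
    (θ : Derivation K (MvPolynomial (Fin n) K) (MvPolynomial (Fin n) K)) (p : ℕ) : Prop :=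
  θ ≠ 0 ∧ ∀ i, (θ (MvPolynomial.X i)).IsHomogeneous p

/-- `A` is free with exponents the multiset `e`: `D(A)` has a homogeneous basis whose
polynomial degrees form the multiset `e`. -/
def HasExponents {n : ℕ} (A : Arrangement K n) (e : Multiset ℕ) : Prop :=
  ∃ Q, IsDefiningPoly A Q ∧
    ∃ (l : List ℕ) (b : Basis (Fin l.length) (MvPolynomial (Fin n) K) (DerModule Q)),
      (l : Multiset ℕ) = e ∧ ∀ i : Fin l.length, IsHomogeneousDer ((b i : DerModule Q) :
        Derivation K (MvPolynomial (Fin n) K) (MvPolynomial (Fin n) K)) (l.get i)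

/-- `B` is (a model, via a linear identification `H ≅ K^n`, of) the restriction `A^H`. -/
def IsRestriction {n : ℕ} (A : Arrangement K (n + 1)) (H : Submodule K (Fin (n + 1) → K))
    (B : Arrangement K n) : Prop :=
  ∃ e : H ≃ₗ[K] (Fin n → K),
    B.hyperplanes = (A.hyperplanes.erase H).image
      (fun H' => Submodule.map (e : H →ₗ[K] (Fin n → K)) (H'.comap H.subtype))

variable (K) in
/-- The class of inductively free arrangements. -/
inductive InductivelyFree : {n : ℕ} → Arrangement K n → Prop
  | empty (n : ℕ) : InductivelyFree (emptyArr K n)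
  | add {n : ℕ} (A : Arrangement K (n + 1)) (H : Submodule K (Fin (n + 1) → K))
      (hH : H ∈ A.hyperplanes) (B : Arrangement K n) (hB : IsRestriction A H B)
      (e' e'' : Multiset ℕ)
      (h1 : InductivelyFree (A.delete H)) (h2 : InductivelyFree B)
      (h3 : HasExponents (A.delete H) e') (h4 : HasExponents B e'')
      (h5 : e'' ≤ e') : InductivelyFree A

variable (K) in
/-- The class of recursively free arrangements. -/
inductive RecursivelyFree : {n : ℕ} → Arrangement K n → Prop
  | empty (n : ℕ) : RecursivelyFree (emptyArr K n)
  | add {n : ℕ} (A : Arrangement K (n + 1)) (H : Submodule K (Fin (n + 1) → K))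
      (hH : H ∈ A.hyperplanes) (B : Arrangement K n) (hB : IsRestriction A H B)
      (e' e'' : Multiset ℕ)
      (h1 : RecursivelyFree (A.delete H)) (h2 : RecursivelyFree B)
      (h3 : HasExponents (A.delete H) e') (h4 : HasExponents B e'')
      (h5 : e'' ≤ e') : RecursivelyFree A
  | del {n : ℕ} (A : Arrangement K (n + 1)) (H : Submodule K (Fin (n + 1) → K))
      (hH : H ∈ A.hyperplanes) (B : Arrangement K n) (hB : IsRestriction A H B)
      (e e'' : Multiset ℕ)
      (h1 : RecursivelyFree A) (h2 : RecursivelyFree B)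
      (h3 : HasExponents A e) (h4 : HasExponents B e'')
      (h5 : e'' ≤ e) : RecursivelyFree (A.delete H)

/-- The intersection lattice of a set of hyperplanes: all intersections of finite
subsets (including the ambient space `⊤` as the empty intersection). -/
def setLattice {n : ℕ} (𝓐 : Set (Submodule K (Fin n → K))) : Set (Submodule K (Fin n → K)) :=
  {X | ∃ s : Finset (Submodule K (Fin n → K)), ↑s ⊆ 𝓐 ∧ X = s.inf id}

/-- The intersection lattice of an arrangement. -/
def Arrangement.lattice {n : ℕ} (A : Arrangement K n) : Set (Submodule K (Fin n → K)) :=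
  setLattice (↑A.hyperplanes)

/-- The linear form `x ↦ ∑ v i * x i` attached to a normal vector `v`. -/
noncomputable def lf {n : ℕ} (v : Fin n → K) : (Fin n → K) →ₗ[K] K :=
  ∑ i, v i • LinearMap.proj i

lemma lf_single {n : ℕ} (v : Fin n → K) (j : Fin n) : lf v (Pi.single j 1) = v j := by
  simp [lf, Pi.single_apply, mul_ite, Finset.sum_ite_eq']

lemma lf_ne_zero {n : ℕ} {v : Fin n → K} (hv : v ≠ 0) : lf v ≠ 0 := by
  intro h
  apply hv
  funext j
  have := congrArg (fun f : (Fin n → K) →ₗ[K] K => f (Pi.single j 1)) h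
  simpa [lf_single] using this

/-- The hyperplane `v^⊥` with normal vector `v`. -/
noncomputable def perp {n : ℕ} (v : Fin n → K) : Submodule K (Fin n → K) :=
  LinearMap.ker (lf v)

/-- Build an arrangement from a finite set of nonzero normal vectors. -/
noncomputable def mkArr {n : ℕ} (vs : Finset (Fin n → K)) (h : (0 : Fin n → K) ∉ vs) :
    Arrangement K n :=
  ⟨vs.image perp, by
    intro H hH
    obtain ⟨v, hv, rfl⟩ := Finset.mem_image.mp hH
    exact ⟨lf v, lf_ne_zero (fun h0 => h (h0 ▸ hv)), rfl⟩⟩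

end Arrgt

namespace Arrgt

/-- The integer combination `a + b ζ + c ζ² + d ζ³` of powers of a primitive fifth root of unity,
as a computable element of `ℤ[ζ]`. -/
@[ext]
structure Cyc where
  a : ℤ
  b : ℤ
  c : ℤ
  d : ℤ

namespace Cyc

instance : DecidableEq Cyc := fun x y =>
  decidable_of_iff (x.a = y.a ∧ x.b = y.b ∧ x.c = y.c ∧ x.d = y.d) Cyc.ext_iff.symm

instance : Zero Cyc := ⟨⟨0, 0, 0, 0⟩⟩

instance : Add Cyc := ⟨fun x y => ⟨x.a + y.a, x.b + y.b, x.c + y.c, x.d + y.d⟩⟩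

instance : Sub Cyc := ⟨fun x y => ⟨x.a - y.a, x.b - y.b, x.c - y.c, x.d - y.d⟩⟩

/-- Multiplication is reduced with `ζ⁴ = -1 - ζ - ζ² - ζ³`. -/
instance : Mul Cyc := ⟨fun x y =>
  let e := x.b * y.d + x.c * y.c + x.d * y.b
  ⟨x.a * y.a + (x.c * y.d + x.d * y.c) - e,
   x.a * y.b + x.b * y.a + x.d * y.d - e,
   x.a * y.c + x.b * y.b + x.c * y.a - e,
   x.a * y.d + x.b * y.c + x.c * y.b + x.d * y.a - e⟩⟩

/-- The value of an element of `ℤ[ζ]` at a complex number. -/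
def eval (ζ : ℂ) (x : Cyc) : ℂ := x.a + x.b * ζ + x.c * ζ ^ 2 + x.d * ζ ^ 3

lemma eval_zero (ζ : ℂ) : eval ζ 0 = 0 := by
  change ((0 : ℤ) : ℂ) + (0 : ℤ) * ζ + (0 : ℤ) * ζ ^ 2 + (0 : ℤ) * ζ ^ 3 = 0
  simp

lemma eval_add (ζ : ℂ) (x y : Cyc) : eval ζ (x + y) = eval ζ x + eval ζ y := by
  change ((x.a + y.a : ℤ) : ℂ) + (x.b + y.b : ℤ) * ζ + (x.c + y.c : ℤ) * ζ ^ 2 +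
    (x.d + y.d : ℤ) * ζ ^ 3 = _
  simp only [eval]
  push_cast
  ring

variable {ζ : ℂ}

lemma sum_pow_eq_zero (hζ : IsPrimitiveRoot ζ 5) : 1 + ζ + ζ ^ 2 + ζ ^ 3 + ζ ^ 4 = 0 := by
  simpa [Finset.sum_range_succ] using hζ.geom_sum_eq_zero (by norm_num)

lemma eval_mul (hζ : IsPrimitiveRoot ζ 5) (x y : Cyc) :
    eval ζ (x * y) = eval ζ x * eval ζ y := by
  have h := sum_pow_eq_zero hζ
  change ((x.a * y.a + (x.c * y.d + x.d * y.c) - (x.b * y.d + x.c * y.c + x.d * y.b) : ℤ) : ℂ) +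
    (x.a * y.b + x.b * y.a + x.d * y.d - (x.b * y.d + x.c * y.c + x.d * y.b) : ℤ) * ζ +
    (x.a * y.c + x.b * y.b + x.c * y.a - (x.b * y.d + x.c * y.c + x.d * y.b) : ℤ) * ζ ^ 2 +
    (x.a * y.d + x.b * y.c + x.c * y.b + x.d * y.a -
      (x.b * y.d + x.c * y.c + x.d * y.b) : ℤ) * ζ ^ 3 = _
  simp only [eval]
  push_cast
  linear_combination (-(x.b * y.d + x.c * y.c + x.d * y.b : ℂ) -
    (ζ - 1) * (x.c * y.d + x.d * y.c + ζ * (x.d * y.d))) * h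

lemma eval_eq_zero_iff (hζ : IsPrimitiveRoot ζ 5) {x : Cyc} : eval ζ x = 0 ↔ x = 0 := by
  refine ⟨fun h => ?_, fun h => h ▸ eval_zero ζ⟩
  let p : Polynomial ℚ := Polynomial.C (x.a : ℚ) + Polynomial.C (x.b : ℚ) * Polynomial.X +
    Polynomial.C (x.c : ℚ) * Polynomial.X ^ 2 + Polynomial.C (x.d : ℚ) * Polynomial.X ^ 3
  have hp : p = 0 := by
    by_contra hp
    have hle := minpoly.degree_le_of_ne_zero ℚ ζ hp (by simpa [p, eval] using h)
    rw [← Polynomial.cyclotomic_eq_minpoly_rat hζ (by norm_num),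
      Polynomial.degree_cyclotomic, Nat.totient_prime Nat.prime_five] at hle
    have hlt : p.degree ≤ 3 := by
      simp only [p]
      compute_degree
    exact absurd (hle.trans hlt) (by decide)
  have hc (n : ℕ) : p.coeff n = 0 := by simp [hp]
  simp only [p, Polynomial.coeff_add, Polynomial.coeff_C_mul, Polynomial.coeff_X_pow,
    Polynomial.coeff_C, Polynomial.coeff_X] at hc
  have h0 : x.a = 0 := by simpa using hc 0
  have h1 : x.b = 0 := by simpa using hc 1
  have h2 : x.c = 0 := by simpa using hc 2
  have h3 : x.d = 0 := by simpa using hc 3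
  exact Cyc.ext h0 h1 h2 h3

end Cyc

/-- The bilinear form `u ↦ v ↦ ∑ uᵢ vᵢ` on `ℤ[ζ]³`. -/
def cycDot (u v : Fin 3 → Cyc) : Cyc := u 0 * v 0 + u 1 * v 1 + u 2 * v 2

/-- The cross product on `ℤ[ζ]³`. -/
def cycCross (u v : Fin 3 → Cyc) : Fin 3 → Cyc :=
  ![u 1 * v 2 - u 2 * v 1, u 2 * v 0 - u 0 * v 2, u 0 * v 1 - u 1 * v 0]

/-- The product of a row vector with a matrix, over `ℤ[ζ]`. -/
def cycVecMul (v : Fin 3 → Cyc) (M : Fin 3 → Fin 3 → Cyc) : Fin 3 → Cyc :=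
  fun j => cycDot v fun i => M i j

/-- The three generators of the reflection group of type `H₃`. -/
def generator : Fin 3 → Fin 3 → Fin 3 → Cyc :=
  ![![![⟨1, 0, 0, 0⟩, 0, 0], ![0, ⟨1, 0, 0, 0⟩, ⟨1, 0, 0, 0⟩], ![0, 0, ⟨-1, 0, 0, 0⟩]],
    ![![⟨-1, 0, 0, 0⟩, 0, 0], ![⟨0, 0, -1, -1⟩, ⟨1, 0, 0, 0⟩, 0], ![0, 0, ⟨1, 0, 0, 0⟩]],
    ![![⟨1, 0, 0, 0⟩, ⟨0, 0, -1, -1⟩, 0], ![0, ⟨-1, 0, 0, 0⟩, 0],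
      ![0, ⟨1, 0, 0, 0⟩, ⟨1, 0, 0, 0⟩]]]

/-- The roots of unity `± ζᵏ` of `ℤ[ζ]`. -/
def rootsOfUnity : List Cyc :=
  [⟨1, 0, 0, 0⟩, ⟨0, 1, 0, 0⟩, ⟨0, 0, 1, 0⟩, ⟨0, 0, 0, 1⟩, ⟨-1, -1, -1, -1⟩,
    ⟨-1, 0, 0, 0⟩, ⟨0, -1, 0, 0⟩, ⟨0, 0, -1, 0⟩, ⟨0, 0, 0, -1⟩, ⟨1, 1, 1, 1⟩]

/-- Normal vectors of the 27 hyperplanes: the standard basis and `(1, -ζ², 0)` come first, and every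
later one is the image of an earlier one under a generator. -/
def normals : List (Fin 3 → Cyc) :=
  [
    ![⟨1, 0, 0, 0⟩, ⟨0, 0, 0, 0⟩, ⟨0, 0, 0, 0⟩], ![⟨0, 0, 0, 0⟩, ⟨1, 0, 0, 0⟩, ⟨0, 0, 0, 0⟩],
    ![⟨0, 0, 0, 0⟩, ⟨0, 0, 0, 0⟩, ⟨1, 0, 0, 0⟩], ![⟨1, 0, 0, 0⟩, ⟨0, 0, -1, 0⟩, ⟨0, 0, 0, 0⟩],
    ![⟨1, 0, 0, 0⟩, ⟨0, 0, -1, -1⟩, ⟨0, 0, 0, 0⟩], ![⟨0, 0, 0, 0⟩, ⟨1, 0, 0, 0⟩, ⟨1, 0, 0, 0⟩],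
    ![⟨0, 0, -1, -1⟩, ⟨1, 0, 0, 0⟩, ⟨0, 0, 0, 0⟩], ![⟨1, 0, 0, 0⟩, ⟨0, 0, -1, 0⟩, ⟨0, 0, -1, 0⟩],
    ![⟨-1, -1, -1, -1⟩, ⟨0, 0, -1, 0⟩, ⟨0, 0, 0, 0⟩],
    ![⟨1, 0, 0, 0⟩, ⟨0, 0, -1, -1⟩, ⟨0, 0, -1, -1⟩],
    ![⟨0, 0, -1, -1⟩, ⟨0, 0, -1, -1⟩, ⟨0, 0, 0, 0⟩],
    ![⟨0, 0, -1, -1⟩, ⟨1, 0, 0, 0⟩, ⟨1, 0, 0, 0⟩],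
    ![⟨-1, -1, -1, -1⟩, ⟨0, 0, -1, 0⟩, ⟨0, 0, -1, 0⟩],
    ![⟨1, 0, 0, 0⟩, ⟨0, 0, -1, -1⟩, ⟨0, 0, -1, 0⟩],
    ![⟨0, 0, -1, -1⟩, ⟨0, 0, -1, -1⟩, ⟨0, 0, -1, -1⟩],
    ![⟨0, 0, -1, -1⟩, ⟨1, 0, -1, -1⟩, ⟨1, 0, 0, 0⟩],
    ![⟨-1, -1, -1, -1⟩, ⟨0, -1, -1, 0⟩, ⟨0, 0, -1, 0⟩],
    ![⟨0, 0, -1, -1⟩, ⟨0, 0, -1, -1⟩, ⟨0, 0, -1, 0⟩],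
    ![⟨0, 0, -1, -1⟩, ⟨1, 0, -1, -1⟩, ⟨0, 0, -1, -1⟩],
    ![⟨1, 0, -1, -1⟩, ⟨1, 0, -1, -1⟩, ⟨1, 0, 0, 0⟩],
    ![⟨0, -1, -1, 0⟩, ⟨0, -1, -1, 0⟩, ⟨0, 0, -1, 0⟩],
    ![⟨0, 0, -1, -1⟩, ⟨1, 0, -1, 0⟩, ⟨0, 0, -1, 0⟩],
    ![⟨1, 0, -1, -1⟩, ⟨1, 0, -1, -1⟩, ⟨0, 0, -1, -1⟩],
    ![⟨0, -1, -1, 0⟩, ⟨-1, -1, -2, -1⟩, ⟨0, 0, -1, 0⟩],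
    ![⟨0, 0, -1, -1⟩, ⟨1, 0, -1, 0⟩, ⟨1, 0, 0, 0⟩],
    ![⟨0, -1, -1, -1⟩, ⟨1, 0, -1, 0⟩, ⟨0, 0, -1, 0⟩],
    ![⟨1, 0, -1, -1⟩, ⟨0, 0, -2, -2⟩, ⟨0, 0, -1, -1⟩]]

/-- The 91 intersection points, each given by the indices of the hyperplanes through it. -/
def points : List (List ℕ) :=
  [
    [0, 1, 3, 4, 6, 8, 10], [0, 2], [0, 5, 7, 9, 11, 12, 14], [0, 13, 17], [0, 15, 19],
    [0, 16, 20], [0, 18, 22], [0, 21, 25], [0, 23, 24], [0, 26], [1, 2, 5], [1, 7, 13], [1, 9],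
    [1, 11, 15, 22, 24, 25, 26], [1, 12, 16], [1, 14, 18], [1, 17, 21], [1, 19], [1, 20, 23],
    [2, 3, 7], [2, 4, 9, 13, 15, 16, 18], [2, 6, 11], [2, 8, 12], [2, 10, 14, 17, 19, 20, 22],
    [2, 21, 24], [2, 23, 25], [2, 26], [3, 5, 16], [3, 9, 24], [3, 11, 17], [3, 12, 26],
    [3, 13, 22], [3, 14, 21], [3, 15, 23], [3, 18, 20], [3, 19, 25], [4, 5], [4, 7, 21],
    [4, 11, 19], [4, 12, 23], [4, 14, 26], [4, 17, 24], [4, 20, 25], [4, 22],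
    [5, 6, 18, 19, 21, 23, 26], [5, 8, 13], [5, 10, 15], [5, 17, 25], [5, 20, 24], [5, 22],
    [6, 7, 20], [6, 9, 22], [6, 12, 17], [6, 13, 25], [6, 14], [6, 15], [6, 16, 24], [7, 8, 26],
    [7, 10, 24], [7, 15, 17], [7, 16, 19], [7, 18, 25], [7, 22, 23], [8, 9, 25], [8, 11, 20],
    [8, 14, 23], [8, 15, 21], [8, 16, 22], [8, 17, 18], [8, 19, 24], [9, 10, 26], [9, 17, 23],
    [9, 19], [9, 20, 21], [10, 11], [10, 12, 25], [10, 13, 23], [10, 16, 21], [10, 18],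
    [11, 13, 21], [11, 16, 23], [11, 18], [12, 13, 19], [12, 15, 20], [12, 18, 24], [12, 21, 22],
    [13, 14, 24], [13, 20, 26], [14, 15], [14, 16, 25], [16, 17, 26]]

/-- The normal vector with the given index, or zero if there is none. -/
def normal (i : ℕ) : Fin 3 → Cyc := normals.getD i fun _ => 0

/-- A vector orthogonal to the first two of the normal vectors with the given indices. -/
def direction (t : List ℕ) : Fin 3 → Cyc :=
  cycCross (normal (t.getD 0 0)) (normal (t.getD 1 0))

lemma cycDot_normal_direction :
    ∀ t ∈ points, ∀ i < 27, cycDot (normal i) (direction t) = 0 ↔ i ∈ t := by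
  decide +kernel

lemma exists_point_through_pair : ∀ i < 27, ∀ j < 27, ∃ t ∈ points, i ∈ t ∧ j ∈ t := by
  decide +kernel

lemma eq_of_mem_points_imp :
    ∀ i < 27, ∀ j < 27, (∀ t ∈ points, i ∈ t → j ∈ t) → i = j := by
  decide +kernel

lemma exists_pair_mem_of_mem_points : ∀ t ∈ points, ∃ i ∈ t, ∃ j ∈ t, i ≠ j := by
  decide +kernel

lemma exists_not_mem_of_mem_points : ∀ t ∈ points, ∃ i < 27, i ∉ t := by
  decide +kernel

lemma lt_of_mem_points : ∀ t ∈ points, ∀ i ∈ t, i < 27 := by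
  decide +kernel

lemma nodup_of_mem_points : ∀ t ∈ points, t.Nodup := by
  decide +kernel

lemma eq_of_subset_of_mem_points :
    ∀ t ∈ points, ∀ s ∈ points, (∀ i ∈ t, i ∈ s) → t = s := by
  decide +kernel

lemma length_of_mem_points : ∀ t ∈ points, t.length = 2 ∨ t.length = 3 ∨ t.length = 7 := by
  decide +kernel

lemma normal_vecMul_generator :
    ∀ i < 27, ∀ a, ∃ j < 27, ∃ u ∈ rootsOfUnity,
      ∀ t, cycVecMul (normal i) (generator a) t = u * normal j t := by
  decide +kernel

lemma normal_eq_vecMul_generator :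
    ∀ i < 27, 4 ≤ i →
      ∃ j < i, ∃ a, ∀ t, normal i t = cycVecMul (normal j) (generator a) t := by
  decide +kernel

lemma card_points_filter :
    (points.toFinset.filter fun t => t.length = 2).card = 15 ∧
    (points.toFinset.filter fun t => t.length = 3).card = 70 ∧
    (points.toFinset.filter fun t => t.length = 7).card = 6 := by
  decide +kernel

lemma zero_not_mem_rootsOfUnity : (0 : Cyc) ∉ rootsOfUnity := by
  decide +kernel

section Plane

variable {K : Type*} [Field K]

lemma mem_perp {n : ℕ} {v x : Fin n → K} : x ∈ perp v ↔ ∑ i, v i * x i = 0 := by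
  simp [perp, lf]

lemma perp_smul {n : ℕ} {c : K} (hc : c ≠ 0) (v : Fin n → K) : perp (c • v) = perp v := by
  ext x
  simp [mem_perp, mul_assoc, ← Finset.mul_sum, hc]

lemma finrank_perp_add_one {n : ℕ} {v : Fin n → K} (hv : v ≠ 0) :
    Module.finrank K (perp v) + 1 = n := by
  rw [perp, Module.Dual.finrank_ker_add_one_of_ne_zero (lf_ne_zero hv), Module.finrank_fin_fun]

lemma finrank_perp_inf_perp {v w : Fin 3 → K} (hv : v ≠ 0) (hw : w ≠ 0)
    (h : perp v ≠ perp w) : Module.finrank K (perp v ⊓ perp w : Submodule K (Fin 3 → K)) = 1 := by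
  have h1 := finrank_perp_add_one hv
  have h2 := finrank_perp_add_one hw
  have h3 := Submodule.finrank_sup_add_finrank_inf_eq (perp v) (perp w)
  have hle : perp v < perp v ⊔ perp w := by
    refine lt_of_le_of_ne le_sup_left fun he => h ?_
    exact (Submodule.eq_of_le_of_finrank_eq (he ▸ le_sup_right) (by omega)).symm
  have h4 := Submodule.finrank_lt_finrank_of_lt hle
  have h5 := Submodule.finrank_le (perp v ⊔ perp w)
  rw [Module.finrank_fin_fun] at h5
  omega

end Plane

/-- The complex vector with the given coordinates in `ℤ[ζ]`. -/
def evalVec (ζ : ℂ) (v : Fin 3 → Cyc) : Fin 3 → ℂ := fun i => Cyc.eval ζ (v i)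

/-- The hyperplane of the arrangement with the given index. -/
noncomputable def hyperplane (ζ : ℂ) (i : ℕ) : Submodule ℂ (Fin 3 → ℂ) :=
  perp (evalVec ζ (normal i))

/-- The line in which the hyperplanes with the given indices meet. -/
noncomputable def line (ζ : ℂ) (t : List ℕ) : Submodule ℂ (Fin 3 → ℂ) :=
  Submodule.span ℂ {evalVec ζ (direction t)}

variable {ζ : ℂ}

lemma eval_cycDot (hζ : IsPrimitiveRoot ζ 5) (u v : Fin 3 → Cyc) :
    Cyc.eval ζ (cycDot u v) = ∑ i, evalVec ζ u i * evalVec ζ v i := by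
  simp [cycDot, evalVec, Fin.sum_univ_three, Cyc.eval_add, Cyc.eval_mul hζ]

lemma evalVec_cycVecMul (hζ : IsPrimitiveRoot ζ 5) (v : Fin 3 → Cyc)
    (M : Fin 3 → Fin 3 → Cyc) :
    evalVec ζ (cycVecMul v M) =
      Matrix.vecMul (evalVec ζ v) (Matrix.of fun i => evalVec ζ (M i)) := by
  ext j
  simp only [evalVec, cycVecMul, eval_cycDot hζ]
  rfl

lemma line_le_hyperplane_iff (hζ : IsPrimitiveRoot ζ 5) {t : List ℕ} (ht : t ∈ points)
    {i : ℕ} (hi : i < 27) : line ζ t ≤ hyperplane ζ i ↔ i ∈ t := by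
  rw [line, hyperplane, Submodule.span_singleton_le_iff_mem, mem_perp, ← eval_cycDot hζ,
    Cyc.eval_eq_zero_iff hζ, cycDot_normal_direction t ht i hi]

lemma hyperplane_injOn (hζ : IsPrimitiveRoot ζ 5) : Set.InjOn (hyperplane ζ) (Set.Iio 27) :=
  fun i hi j hj h => eq_of_mem_points_imp i hi j hj fun _ ht hit =>
    (line_le_hyperplane_iff hζ ht hj).1 (h ▸ (line_le_hyperplane_iff hζ ht hi).2 hit)

lemma line_injOn (hζ : IsPrimitiveRoot ζ 5) : Set.InjOn (line ζ) {t | t ∈ points} :=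
  fun t ht s hs h => eq_of_subset_of_mem_points t ht s hs fun i hi =>
    have hlt := lt_of_mem_points t ht i hi
    (line_le_hyperplane_iff hζ hs hlt).1 (h ▸ (line_le_hyperplane_iff hζ ht hlt).2 hi)

lemma evalVec_normal_ne_zero (hζ : IsPrimitiveRoot ζ 5) {i : ℕ} (hi : i < 27) :
    evalVec ζ (normal i) ≠ 0 := by
  intro h
  have key (j : ℕ) (hj : j < 27) : j = i :=
    eq_of_mem_points_imp j hj i hi fun t ht _ => (line_le_hyperplane_iff hζ ht hi).1 fun x _ => by
      simp [hyperplane, mem_perp, h]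
  exact absurd ((key 0 (by norm_num)).trans (key 1 (by norm_num)).symm) (by norm_num)

lemma finrank_line (hζ : IsPrimitiveRoot ζ 5) {t : List ℕ} (ht : t ∈ points) :
    Module.finrank ℂ (line ζ t) = 1 := by
  refine finrank_span_singleton fun h => ?_
  obtain ⟨i, hi, hit⟩ := exists_not_mem_of_mem_points t ht
  exact hit ((line_le_hyperplane_iff hζ ht hi).1 (by simp [line, h]))

lemma finrank_hyperplane_inf (hζ : IsPrimitiveRoot ζ 5) {i j : ℕ} (hi : i < 27) (hj : j < 27)
    (hij : i ≠ j) :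
    Module.finrank ℂ (hyperplane ζ i ⊓ hyperplane ζ j : Submodule ℂ (Fin 3 → ℂ)) = 1 :=
  finrank_perp_inf_perp (evalVec_normal_ne_zero hζ hi) (evalVec_normal_ne_zero hζ hj)
    fun h => hij (hyperplane_injOn hζ hi hj h)

lemma hyperplane_inf_hyperplane (hζ : IsPrimitiveRoot ζ 5) {t : List ℕ} (ht : t ∈ points)
    {i j : ℕ} (hi : i ∈ t) (hj : j ∈ t) (hij : i ≠ j) :
    hyperplane ζ i ⊓ hyperplane ζ j = line ζ t := by
  have hi' := lt_of_mem_points t ht i hi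
  have hj' := lt_of_mem_points t ht j hj
  refine (Submodule.eq_of_le_of_finrank_eq (le_inf ?_ ?_) ?_).symm
  · exact (line_le_hyperplane_iff hζ ht hi').2 hi
  · exact (line_le_hyperplane_iff hζ ht hj').2 hj
  · rw [finrank_line hζ ht, finrank_hyperplane_inf hζ hi' hj' hij]

lemma ncard_hyperplanes_through (hζ : IsPrimitiveRoot ζ 5) {t : List ℕ} (ht : t ∈ points) :
    {H ∈ hyperplane ζ '' Set.Iio 27 | line ζ t ≤ H}.ncard = t.length := by
  have h : {H ∈ hyperplane ζ '' Set.Iio 27 | line ζ t ≤ H} = hyperplane ζ '' {i | i ∈ t} := by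
    ext H
    constructor
    · rintro ⟨⟨i, hi, rfl⟩, hH⟩
      exact ⟨i, (line_le_hyperplane_iff hζ ht hi).1 hH, rfl⟩
    · rintro ⟨i, hi, rfl⟩
      have hlt := lt_of_mem_points t ht i hi
      exact ⟨⟨i, hlt, rfl⟩, (line_le_hyperplane_iff hζ ht hlt).2 hi⟩
  have hsub : {i | i ∈ t} ⊆ Set.Iio 27 := lt_of_mem_points t ht
  rw [h, ((hyperplane_injOn hζ).mono hsub).ncard_image,
    ← List.toFinset_card_of_nodup (nodup_of_mem_points t ht), ← Set.ncard_coe_finset]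
  simp

lemma line_mem_setLattice (hζ : IsPrimitiveRoot ζ 5) {t : List ℕ} (ht : t ∈ points) :
    line ζ t ∈ setLattice (hyperplane ζ '' Set.Iio 27) := by
  obtain ⟨i, hi, j, hj, hij⟩ := exists_pair_mem_of_mem_points t ht
  refine ⟨{hyperplane ζ i, hyperplane ζ j}, ?_, ?_⟩
  · simp only [Finset.coe_insert, Finset.coe_singleton]
    exact Set.insert_subset ⟨i, lt_of_mem_points t ht i hi, rfl⟩
      (Set.singleton_subset_iff.2 ⟨j, lt_of_mem_points t ht j hj, rfl⟩)
  · rw [Finset.inf_insert, Finset.inf_singleton]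
    exact (hyperplane_inf_hyperplane hζ ht hi hj hij).symm

lemma exists_eq_line (hζ : IsPrimitiveRoot ζ 5) {p : Submodule ℂ (Fin 3 → ℂ)}
    (hp : p ∈ setLattice (hyperplane ζ '' Set.Iio 27)) (h1 : Module.finrank ℂ p = 1) :
    ∃ t ∈ points, p = line ζ t := by
  obtain ⟨s, hs, rfl⟩ := hp
  obtain ⟨H, hH⟩ : s.Nonempty := by
    by_contra h
    rw [Finset.not_nonempty_iff_eq_empty.1 h, Finset.inf_empty, finrank_top,
      Module.finrank_fin_fun] at h1
    norm_num at h1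
  obtain ⟨i, hi, rfl⟩ := hs hH
  obtain ⟨H', hH', hne⟩ : ∃ H' ∈ s, ¬ hyperplane ζ i ≤ H' := by
    by_contra! h
    have h2 := finrank_perp_add_one (evalVec_normal_ne_zero hζ hi)
    have h3 : s.inf id = hyperplane ζ i := le_antisymm (Finset.inf_le hH) (Finset.le_inf h)
    rw [h3, hyperplane] at h1
    omega
  obtain ⟨j, hj, rfl⟩ := hs hH'
  have hij : i ≠ j := by
    rintro rfl
    exact hne le_rfl
  obtain ⟨t, ht, hit, hjt⟩ := exists_point_through_pair i hi j hj
  refine ⟨t, ht, ?_⟩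
  rw [← hyperplane_inf_hyperplane hζ ht hit hjt hij]
  refine Submodule.eq_of_le_of_finrank_eq (le_inf (Finset.inf_le hH) (Finset.inf_le hH')) ?_
  rw [h1, finrank_hyperplane_inf hζ hi hj hij]

lemma ncard_points_with_multiplicity (hζ : IsPrimitiveRoot ζ 5) (m : ℕ) :
    {p ∈ setLattice (hyperplane ζ '' Set.Iio 27) | Module.finrank ℂ p = 1 ∧
      {H ∈ hyperplane ζ '' Set.Iio 27 | p ≤ H}.ncard = m}.ncard =
      (points.toFinset.filter fun t => t.length = m).card := by
  have h : {p ∈ setLattice (hyperplane ζ '' Set.Iio 27) | Module.finrank ℂ p = 1 ∧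
      {H ∈ hyperplane ζ '' Set.Iio 27 | p ≤ H}.ncard = m} =
      line ζ '' (points.toFinset.filter fun t => t.length = m) := by
    ext p
    constructor
    · rintro ⟨hp, h1, hm⟩
      obtain ⟨t, ht, rfl⟩ := exists_eq_line hζ hp h1
      rw [ncard_hyperplanes_through hζ ht] at hm
      exact ⟨t, by simp [ht, hm], rfl⟩
    · rintro ⟨t, ht, rfl⟩
      obtain ⟨ht, hm⟩ : t ∈ points ∧ t.length = m := by simpa using ht
      exact ⟨line_mem_setLattice hζ ht, finrank_line hζ ht,
        (ncard_hyperplanes_through hζ ht).trans hm⟩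
  have hsub : ((points.toFinset.filter fun t => t.length = m : Finset (List ℕ)) : Set (List ℕ)) ⊆
      {t | t ∈ points} := fun t ht => List.mem_toFinset.1 (Finset.mem_filter.1 ht).1
  rw [h, ((line_injOn hζ).mono hsub).ncard_image, Set.ncard_coe_finset]

/-- The complex matrix of a generator of the reflection group of type `H₃`. -/
noncomputable def generatorMatrix (ζ : ℂ) (a : Fin 3) : Matrix (Fin 3) (Fin 3) ℂ :=
  Matrix.of fun i => evalVec ζ (generator a i)

lemma generatorMatrix_eq (ζ : ℂ) :
    generatorMatrix ζ 0 = !![1, 0, 0; 0, 1, 1; 0, 0, -1] ∧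
    generatorMatrix ζ 1 = !![-1, 0, 0; -ζ ^ 2 - ζ ^ 3, 1, 0; 0, 0, 1] ∧
    generatorMatrix ζ 2 = !![1, -ζ ^ 2 - ζ ^ 3, 0; 0, -1, 0; 0, 1, 1] := by
  refine ⟨?_, ?_, ?_⟩ <;> ext i j <;> fin_cases i <;> fin_cases j <;>
    simp [generatorMatrix, generator, evalVec, Cyc.eval_zero] <;> simp [Cyc.eval] <;> ring

lemma generatorMatrix_mul_self (ζ : ℂ) (a : Fin 3) :
    generatorMatrix ζ a * generatorMatrix ζ a = 1 := by
  obtain ⟨h0, h1, h2⟩ := generatorMatrix_eq ζ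
  fin_cases a <;> simp only [Fin.zero_eta, Fin.mk_one, Fin.reduceFinMk, h0, h1, h2] <;>
    ext i j <;> fin_cases i <;> fin_cases j <;> simp [Matrix.mul_apply, Fin.sum_univ_three] <;>
    ring

lemma exists_vecMul_normal_eq_smul (hζ : IsPrimitiveRoot ζ 5) {S : Set (GL (Fin 3) ℂ)}
    (hS : ∀ g ∈ S, ∃ a, (g : Matrix (Fin 3) (Fin 3) ℂ) = generatorMatrix ζ a)
    {g : GL (Fin 3) ℂ} (hg : g ∈ Subgroup.closure S) {i : ℕ} (hi : i < 27) :
    ∃ j < 27, ∃ c : ℂ, c ≠ 0 ∧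
      Matrix.vecMul (evalVec ζ (normal i)) (g : Matrix (Fin 3) (Fin 3) ℂ) =
        c • evalVec ζ (normal j) := by
  have hgen (a : Fin 3) (i : ℕ) (hi : i < 27) : ∃ j < 27, ∃ c : ℂ, c ≠ 0 ∧
      Matrix.vecMul (evalVec ζ (normal i)) (generatorMatrix ζ a) =
        c • evalVec ζ (normal j) := by
    obtain ⟨j, hj, u, hu, h⟩ := normal_vecMul_generator i hi a
    refine ⟨j, hj, Cyc.eval ζ u, fun h0 => ?_, ?_⟩
    · exact zero_not_mem_rootsOfUnity ((Cyc.eval_eq_zero_iff hζ).1 h0 ▸ hu)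
    · rw [generatorMatrix, ← evalVec_cycVecMul hζ]
      ext t
      simp [evalVec, h, Cyc.eval_mul hζ]
  induction hg using Subgroup.closure_induction'' generalizing i with
  | mem g hg =>
    obtain ⟨a, ha⟩ := hS g hg
    exact ha ▸ hgen a i hi
  | inv_mem g hg =>
    obtain ⟨a, ha⟩ := hS g hg
    have hinv : g⁻¹ = g := inv_eq_of_mul_eq_one_left <| Units.ext <| by
      simp [ha, generatorMatrix_mul_self]
    exact hinv ▸ ha ▸ hgen a i hi
  | one => exact ⟨i, hi, 1, one_ne_zero, by simp⟩
  | mul g h _ _ ihg ihh =>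
    obtain ⟨j, hj, c, hc, hgj⟩ := ihg hi
    obtain ⟨k, hk, d, hd, hhk⟩ := ihh hj
    exact ⟨k, hk, c * d, mul_ne_zero hc hd, by
      rw [Units.val_mul, ← Matrix.vecMul_vecMul, hgj, Matrix.smul_vecMul, hhk, smul_smul]⟩

lemma evalVec_normal_seeds (ζ : ℂ) :
    (∀ i : Fin 3, evalVec ζ (normal i) = Pi.single i 1) ∧
      evalVec ζ (normal 3) = ![1, -ζ ^ 2, 0] := by
  constructor
  · intro i
    ext j
    fin_cases i <;> fin_cases j <;> simp [evalVec, normal, normals, Cyc.eval]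
  · ext j
    fin_cases j <;> simp [evalVec, normal, normals, Cyc.eval]

lemma exists_orbit_eq_normal (hζ : IsPrimitiveRoot ζ 5) {W : Subgroup (GL (Fin 3) ℂ)}
    (hW : ∀ a, ∃ g ∈ W, (g : Matrix (Fin 3) (Fin 3) ℂ) = generatorMatrix ζ a)
    {i : ℕ} (hi : i < 27) :
    ∃ j < 4, ∃ g ∈ W, evalVec ζ (normal i) =
      Matrix.vecMul (evalVec ζ (normal j)) (g : Matrix (Fin 3) (Fin 3) ℂ) := by
  induction i using Nat.strong_induction_on with
  | _ i ih =>
    by_cases h4 : i < 4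
    · exact ⟨i, h4, 1, one_mem W, by simp⟩
    · obtain ⟨k, hk, a, h⟩ := normal_eq_vecMul_generator i hi (not_lt.1 h4)
      obtain ⟨j, hj, g, hg, hkj⟩ := ih k hk (hk.trans hi)
      obtain ⟨g', hg', ha⟩ := hW a
      refine ⟨j, hj, g * g', mul_mem hg hg', ?_⟩
      rw [Units.val_mul, ← Matrix.vecMul_vecMul, ← hkj, ha, generatorMatrix,
        ← evalVec_cycVecMul hζ, funext h]

end Arrgt

open Arrgt in
/-- In the 27-hyperplane arrangement `𝓐`, the multiset of multiplicities `|𝓐_p|` over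
the one-dimensional elements `p` of the intersection lattice is `{{2^15, 3^70, 7^6}}`. -/
theorem H3A_point_multiplicities
    (ζ : ℂ) (hζ : IsPrimitiveRoot ζ 5)
    (g1 g2 g3 : GL (Fin 3) ℂ)
    (hg1 : (g1 : Matrix (Fin 3) (Fin 3) ℂ) = !![1, 0, 0; 0, 1, 1; 0, 0, -1])
    (hg2 : (g2 : Matrix (Fin 3) (Fin 3) ℂ) = !![-1, 0, 0; -ζ^2 - ζ^3, 1, 0; 0, 0, 1])
    (hg3 : (g3 : Matrix (Fin 3) (Fin 3) ℂ) = !![1, -ζ^2 - ζ^3, 0; 0, -1, 0; 0, 1, 1])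
    (W : Subgroup (GL (Fin 3) ℂ)) (hW : W = Subgroup.closure {g1, g2, g3})
    (R : Set (Fin 3 → ℂ))
    (hR : R = {w | ∃ g ∈ W, ∃ i : Fin 3,
          w = Matrix.vecMul (Pi.single i 1) (g : Matrix (Fin 3) (Fin 3) ℂ)} ∪
        {w | ∃ g ∈ W, w = Matrix.vecMul ![1, -ζ^2, 0] (g : Matrix (Fin 3) (Fin 3) ℂ)})
    (𝓐 : Set (Submodule ℂ (Fin 3 → ℂ))) (h𝓐 : 𝓐 = Arrgt.perp '' R)
    :
    (∀ p ∈ setLattice 𝓐, Module.finrank ℂ p = 1 →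
        {H ∈ 𝓐 | p ≤ H}.ncard ∈ ({2, 3, 7} : Set ℕ)) ∧
      {p ∈ setLattice 𝓐 | Module.finrank ℂ p = 1 ∧ {H ∈ 𝓐 | p ≤ H}.ncard = 2}.ncard = 15 ∧
      {p ∈ setLattice 𝓐 | Module.finrank ℂ p = 1 ∧ {H ∈ 𝓐 | p ≤ H}.ncard = 3}.ncard = 70 ∧
      {p ∈ setLattice 𝓐 | Module.finrank ℂ p = 1 ∧ {H ∈ 𝓐 | p ≤ H}.ncard = 7}.ncard = 6 := by
  obtain ⟨hm1, hm2, hm3⟩ := generatorMatrix_eq ζ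
  obtain ⟨hseed, hseed3⟩ := evalVec_normal_seeds ζ
  have hS : ∀ g ∈ ({g1, g2, g3} : Set (GL (Fin 3) ℂ)),
      ∃ a, (g : Matrix (Fin 3) (Fin 3) ℂ) = generatorMatrix ζ a := by
    rintro g (rfl | rfl | rfl)
    exacts [⟨0, hg1.trans hm1.symm⟩, ⟨1, hg2.trans hm2.symm⟩, ⟨2, hg3.trans hm3.symm⟩]
  have hW' : ∀ a, ∃ g ∈ W, (g : Matrix (Fin 3) (Fin 3) ℂ) = generatorMatrix ζ a := by
    have hsub : ({g1, g2, g3} : Set (GL (Fin 3) ℂ)) ⊆ W := hW ▸ Subgroup.subset_closure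
    intro a
    fin_cases a
    exacts [⟨g1, hsub (by simp), hg1.trans hm1.symm⟩, ⟨g2, hsub (by simp), hg2.trans hm2.symm⟩,
      ⟨g3, hsub (by simp), hg3.trans hm3.symm⟩]
  have hA : 𝓐 = hyperplane ζ '' Set.Iio 27 := by
    have horbit {i : ℕ} (hi : i < 27) {g : GL (Fin 3) ℂ} (hg : g ∈ W) :
        perp (Matrix.vecMul (evalVec ζ (normal i)) (g : Matrix (Fin 3) (Fin 3) ℂ)) ∈
          hyperplane ζ '' Set.Iio 27 := by
      obtain ⟨j, hj, c, hc, h⟩ := exists_vecMul_normal_eq_smul hζ hS (hW ▸ hg) hi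
      exact ⟨j, hj, by rw [h, perp_smul hc, hyperplane]⟩
    rw [h𝓐, hR]
    refine subset_antisymm ?_ ?_
    · rintro _ ⟨_, ⟨g, hg, i, rfl⟩ | ⟨g, hg, rfl⟩, rfl⟩
      · exact hseed i ▸ horbit (by omega) hg
      · exact hseed3 ▸ horbit (by norm_num) hg
    · rintro _ ⟨i, hi, rfl⟩
      obtain ⟨j, hj, g, hg, h⟩ := exists_orbit_eq_normal hζ hW' hi
      refine ⟨_, ?_, rfl⟩
      rw [h]
      obtain hj3 | rfl : j < 3 ∨ j = 3 := by omega
      · exact Or.inl ⟨g, hg, ⟨j, hj3⟩, by rw [← hseed ⟨j, hj3⟩]⟩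
      · exact Or.inr ⟨g, hg, by rw [hseed3]⟩
  subst hA
  obtain ⟨h2, h3, h7⟩ := card_points_filter
  refine ⟨fun p hp h1 => ?_, ?_, ?_, ?_⟩
  · obtain ⟨t, ht, rfl⟩ := exists_eq_line hζ hp h1
    rw [ncard_hyperplanes_through hζ ht]
    exact length_of_mem_points t ht
  · rw [ncard_points_with_multiplicity hζ, h2]
  · rw [ncard_points_with_multiplicity hζ, h3]
  · rw [ncard_points_with_multiplicity hζ, h7]
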